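/- If a tree T of order n(T) ≥ 2 satisfies γ_t^{oi}(S(T)) = (4n(T) − l(T) − s(T))/3, then T belongs to the family F. -/

import Mathlib

open SimpleGraph

universe u

/-- A total outer-independent dominating set: every vertex has a neighbor in `D`,
and the complement of `D` is an independent set. -/
def IsTOIDS {V : Type u} (G : SimpleGraph V) (D : Set V) : Prop :=
  (∀ v : V, ∃ u ∈ D, G.Adj v u) ∧ ∀ u ∉ D, ∀ w ∉ D, ¬ G.Adj u w

/-- The total outer-independent domination number. -/
noncomputable def toidNumber {V : Type u} (G : SimpleGraph V) : ℕ :=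
  sInf {n : ℕ | ∃ D : Set V, IsTOIDS G D ∧ D.ncard = n}

/-- The subdivision graph: each edge is replaced by a new vertex adjacent exactly to
its two endpoints. -/
def subdivision {V : Type u} (G : SimpleGraph V) : SimpleGraph (V ⊕ G.edgeSet) :=
  SimpleGraph.fromRel fun x y =>
    ∃ (v : V) (e : G.edgeSet), x = Sum.inl v ∧ y = Sum.inr e ∧ v ∈ (e : Sym2 V)

/-- A leaf: a vertex with exactly one neighbor. -/
def IsLeafVert {V : Type u} (G : SimpleGraph V) (v : V) : Prop := ∃! u, G.Adj v u

/-- A support vertex: a vertex adjacent to a leaf. -/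
def IsSupportVert {V : Type u} (G : SimpleGraph V) (v : V) : Prop :=
  ∃ u, G.Adj v u ∧ IsLeafVert G u

/-- A strong support vertex: a vertex adjacent to at least two leaves. -/
def IsStrongSupportVert {V : Type u} (G : SimpleGraph V) (v : V) : Prop :=
  ∃ u w, u ≠ w ∧ G.Adj v u ∧ G.Adj v w ∧ IsLeafVert G u ∧ IsLeafVert G w

/-- A strong leaf: a leaf adjacent to a strong support vertex. -/
def IsStrongLeaf {V : Type u} (G : SimpleGraph V) (v : V) : Prop :=
  IsLeafVert G v ∧ ∃ u, G.Adj v u ∧ IsStrongSupportVert G u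

/-- A weak leaf: a leaf that is not a strong leaf. -/
def IsWeakLeaf {V : Type u} (G : SimpleGraph V) (v : V) : Prop :=
  IsLeafVert G v ∧ ¬ IsStrongLeaf G v

/-- A semi-support vertex: neither a leaf nor a support vertex, but adjacent to a
support vertex. -/
def IsSemiSupportVert {V : Type u} (G : SimpleGraph V) (v : V) : Prop :=
  ¬ IsLeafVert G v ∧ ¬ IsSupportVert G v ∧ ∃ u, G.Adj v u ∧ IsSupportVert G u

/-- The number of leaves, with the convention that `P₂` has exactly one leaf. -/
noncomputable def leafCount {V : Type u} (G : SimpleGraph V) : ℕ :=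
  if Nat.card V = 2 then 1 else {v | IsLeafVert G v}.ncard

/-- The number of support vertices, with the convention that `P₂` has exactly one
support vertex. -/
noncomputable def supportCount {V : Type u} (G : SimpleGraph V) : ℕ :=
  if Nat.card V = 2 then 1 else {v | IsSupportVert G v}.ncard

/-- The graph obtained from `G` by attaching a path `P_r` to the vertex `v`:
the new vertices form a path `p₀ p₁ ⋯ p_{r-1}` and `v` is joined to the end `p₀`. -/
def attachPath {V : Type u} (G : SimpleGraph V) (v : V) (r : ℕ) :
    SimpleGraph (V ⊕ Fin r) :=
  SimpleGraph.fromRel fun x y =>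
    (∃ a b, x = Sum.inl a ∧ y = Sum.inl b ∧ G.Adj a b) ∨
    (∃ i j : Fin r, x = Sum.inr i ∧ y = Sum.inr j ∧ (j : ℕ) = (i : ℕ) + 1) ∨
    (∃ i : Fin r, x = Sum.inl v ∧ y = Sum.inr i ∧ (i : ℕ) = 0)

/-- The graph obtained from `G` by adding a disjoint copy of the tree `Q_r`
(`r` paths `P₃` joined to a central vertex) and identifying the central vertex
of `Q_r` with the vertex `v` of `G`. -/
def attachQ {V : Type u} (G : SimpleGraph V) (v : V) (r : ℕ) :
    SimpleGraph (V ⊕ Fin r × Fin 3) :=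
  SimpleGraph.fromRel fun x y =>
    (∃ a b, x = Sum.inl a ∧ y = Sum.inl b ∧ G.Adj a b) ∨
    (∃ i : Fin r, x = Sum.inl v ∧ y = Sum.inr (i, 0)) ∨
    (∃ (i : Fin r) (j k : Fin 3),
      x = Sum.inr (i, j) ∧ y = Sum.inr (i, k) ∧ (k : ℕ) = (j : ℕ) + 1)

/-- The family `F`: all trees obtainable from `P₂` by repeatedly
(F1) attaching `P₁` to a support vertex, (F2) attaching `P₂` to a support or
semi-support vertex, (F3) attaching `P₃` to a weak leaf. -/
inductive InFamilyF : {W : Type u} → SimpleGraph W → Prop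
  | base {W : Type u} (G : SimpleGraph W) (e : G ≃g SimpleGraph.pathGraph 2) :
      InFamilyF G
  | op1 {W : Type u} {G' : SimpleGraph W} {v : W} (hv : IsSupportVert G' v)
      (hF : InFamilyF G') {U : Type u} (G : SimpleGraph U)
      (e : G ≃g attachPath G' v 1) : InFamilyF G
  | op2 {W : Type u} {G' : SimpleGraph W} {v : W}
      (hv : IsSupportVert G' v ∨ IsSemiSupportVert G' v)
      (hF : InFamilyF G') {U : Type u} (G : SimpleGraph U)
      (e : G ≃g attachPath G' v 2) : InFamilyF G
  | op3 {W : Type u} {G' : SimpleGraph W} {v : W} (hv : IsWeakLeaf G' v)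
      (hF : InFamilyF G') {U : Type u} (G : SimpleGraph U)
      (e : G ≃g attachPath G' v 3) : InFamilyF G

/-- The family `𝒯`: all trees obtainable from `P₂` by repeatedly
(O1) attaching `P₁` to a support vertex, (O2) attaching `P₃` to a support vertex or a
weak leaf, (O3) adding a copy of `Q_r` (`r ≥ 2`) identifying its central vertex with a
weak leaf. -/
inductive InFamilyT : {W : Type u} → SimpleGraph W → Prop
  | base {W : Type u} (G : SimpleGraph W) (e : G ≃g SimpleGraph.pathGraph 2) :
      InFamilyT G
  | op1 {W : Type u} {G' : SimpleGraph W} {v : W} (hv : IsSupportVert G' v)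
      (hF : InFamilyT G') {U : Type u} (G : SimpleGraph U)
      (e : G ≃g attachPath G' v 1) : InFamilyT G
  | op2 {W : Type u} {G' : SimpleGraph W} {v : W}
      (hv : IsSupportVert G' v ∨ IsWeakLeaf G' v)
      (hF : InFamilyT G') {U : Type u} (G : SimpleGraph U)
      (e : G ≃g attachPath G' v 3) : InFamilyT G
  | op3 {W : Type u} {G' : SimpleGraph W} {v : W} (hv : IsWeakLeaf G' v)
      (hF : InFamilyT G') {r : ℕ} (hr : 2 ≤ r) {U : Type u} (G : SimpleGraph U)
      (e : G ≃g attachQ G' v r) : InFamilyT G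

section Trees

variable {V : Type u} {G : SimpleGraph V}

/-- If every edge leaving `S` starts at `v ∈ S`, then `S` induces a connected subgraph. -/
theorem connected_induce_of_cut (hG : G.Connected) {S : Set V} {v : V} (hv : v ∈ S)
    (hcut : ∀ s ∈ S, ∀ t ∉ S, G.Adj s t → s = v) : (G.induce S).Connected := by
  classical
  let f : V → S := fun a => if h : a ∈ S then ⟨a, h⟩ else ⟨v, hv⟩
  have hf : ∀ a b, G.Adj a b → (G.induce S).Reachable (f a) (f b) := by
    intro a b hab
    by_cases ha : a ∈ S <;> by_cases hb : b ∈ S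
    · have : (G.induce S).Adj (f a) (f b) := by simpa [f, ha, hb] using hab
      exact this.reachable
    · have := hcut a ha b hb hab
      simp [f, hb, hv, this]
    · have := hcut b hb a ha hab.symm
      simp [f, ha, hv, this]
    · simp [f, ha, hb]
  have hwalk : ∀ a b, G.Walk a b → (G.induce S).Reachable (f a) (f b) := by
    intro a b p
    induction p with
    | nil => rfl
    | cons h _ ih => exact (hf _ _ h).trans ih
  have : Nonempty S := ⟨⟨v, hv⟩⟩
  refine ⟨fun a b => ?_⟩
  obtain ⟨p⟩ := hG a.1 b.1
  simpa [f] using hwalk _ _ p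

theorem isTree_induce_of_cut (hG : G.IsTree) {S : Set V} {v : V} (hv : v ∈ S)
    (hcut : ∀ s ∈ S, ∀ t ∉ S, G.Adj s t → s = v) : (G.induce S).IsTree :=
  ⟨connected_induce_of_cut hG.connected hv hcut, hG.isAcyclic.induce S⟩

/-- In a connected graph, a nonempty set of vertices closed under adjacency is everything. -/
theorem mem_of_closed (hG : G.Connected) {S : Set V} {v : V} (hv : v ∈ S)
    (hS : ∀ a ∈ S, ∀ b, G.Adj a b → b ∈ S) (w : V) : w ∈ S := by
  obtain ⟨p⟩ := hG v w
  induction p with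
  | nil => exact hv
  | cons h _ ih => exact ih (hS _ hv _ h)

/-- In a rooted tree, a vertex has at most one neighbor closer to the root. -/
theorem eq_of_adj_of_dist_lt (hG : G.IsTree) (r : V) {a b c : V} (hab : G.Adj a b)
    (hac : G.Adj a c) (hb : G.dist r b < G.dist r a) (hc : G.dist r c < G.dist r a) : b = c := by
  have key : ∀ x, G.Adj a x → G.dist r x < G.dist r a →
      ∃ p : G.Walk r a, p.IsPath ∧ p.penultimate = x := by
    intro x hax hx
    obtain ⟨p, -, hp⟩ := (hG.connected r x).exists_path_of_dist
    refine ⟨p.concat hax.symm, ?_, by simp⟩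
    apply SimpleGraph.Walk.isPath_of_length_eq_dist
    have := hG.dist_eq_dist_add_one_of_adj r hax
    rw [SimpleGraph.Walk.length_concat, hp]
    omega
  obtain ⟨p, hp, rfl⟩ := key b hab hb
  obtain ⟨q, hq, rfl⟩ := key c hac hc
  rw [(hG.existsUnique_path r a).unique hp hq]

theorem inFamilyF_of_pair {a b : V} (hab : G.Adj a b)
    (h : ∀ w, w = a ∨ w = b) : InFamilyF G := by
  classical
  let f : Fin 2 → V := ![a, b]
  have hf : Function.Bijective f := by
    constructor
    · intro i j
      have := hab.ne
      have := hab.ne'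
      fin_cases i <;> fin_cases j <;> simp_all [f]
    · intro w
      rcases h w with rfl | rfl
      · exact ⟨0, rfl⟩
      · exact ⟨1, rfl⟩
  refine .base G (RelIso.symm ⟨Equiv.ofBijective f hf, ?_⟩)
  intro i j
  have := hab.symm
  fin_cases i <;> fin_cases j <;> simp_all [f, pathGraph_adj]

theorem nonempty_iso_attachPath {r : ℕ} (p : Fin r → V) (hp : Function.Injective p)
    {v : V} (hv : v ∈ (Set.range p)ᶜ)
    (hpp : ∀ i j, G.Adj (p i) (p j) ↔ (j : ℕ) = i + 1 ∨ (i : ℕ) = j + 1)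
    (hsp : ∀ s ∉ Set.range p, ∀ i, G.Adj s (p i) ↔ s = v ∧ (i : ℕ) = 0) :
    Nonempty (G ≃g attachPath (G.induce (Set.range p)ᶜ) ⟨v, hv⟩ r) := by
  let f : ↥(Set.range p)ᶜ ⊕ Fin r → V := Sum.elim Subtype.val p
  have hf : Function.Bijective f := by
    constructor
    · rintro (⟨a, ha⟩ | i) (⟨b, hb⟩ | j) hab
      · simpa [f] using hab
      · exact absurd ⟨j, hab.symm⟩ ha
      · exact absurd ⟨i, hab⟩ hb
      · simpa [f] using hp hab
    · intro w
      by_cases hw : w ∈ Set.range p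
      · obtain ⟨i, rfl⟩ := hw
        exact ⟨Sum.inr i, rfl⟩
      · exact ⟨Sum.inl ⟨w, hw⟩, rfl⟩
  refine ⟨RelIso.symm ⟨Equiv.ofBijective f hf, ?_⟩⟩
  rintro (⟨a, ha⟩ | i) (⟨b, hb⟩ | j)
  · simp only [attachPath, fromRel_adj, f]
    simp only [Equiv.ofBijective_apply, Sum.elim_inl]
    simp [G.adj_comm b a]
    exact fun h => h.ne
  · simp only [attachPath, fromRel_adj, f]
    simp [hsp a ha]
  · simp only [attachPath, fromRel_adj, f]
    simp [G.adj_comm _ b, hsp b hb]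
  · simp only [attachPath, fromRel_adj, f]
    simp [hpp]
    rintro h rfl
    omega

end Trees

/-- The role of a vertex in a partition of a tree into stars and paths `P₃`:
the stars consist of a support vertex and the leaves adjacent to it, and the paths consist of a
middle vertex and two arms. -/
inductive VertexRole
  | leaf
  | support
  | middle
  | arm

/-- A partition of the vertices of `G` into stars (a support vertex together with the leaves
adjacent to it) and paths `P₃` whose middle vertex has degree two in `G` and whose ends have
further neighbors, none of which is a leaf. -/
structure IsStarPathPartition {V : Type u} (G : SimpleGraph V) (c : V → VertexRole) : Prop where
  leaf : ∀ v, c v = .leaf → ∃ s, c s = .support ∧ G.Adj v s ∧ ∀ w, G.Adj v w → w = s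
  support : ∀ v, c v = .support → ∃ l, c l = .leaf ∧ G.Adj v l
  middle : ∀ v, c v = .middle → ∃ x z, x ≠ z ∧ c x = .arm ∧ c z = .arm ∧ G.Adj v x ∧ G.Adj v z ∧
    ∀ w, G.Adj v w → w = x ∨ w = z
  arm : ∀ v, c v = .arm → ∃ m, c m = .middle ∧ G.Adj v m ∧
    (∀ m', c m' = .middle → G.Adj v m' → m' = m) ∧ ∃ w, w ≠ m ∧ G.Adj v w

namespace IsStarPathPartition

variable {V : Type u} {G : SimpleGraph V} {c : V → VertexRole}

theorem exists_adj (h : IsStarPathPartition G c) (v : V) : ∃ w, G.Adj v w := by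
  have h1 := h.leaf v
  have h2 := h.support v
  have h3 := h.middle v
  have h4 := h.arm v
  cases hc : c v <;> grind

theorem role_of_isLeafVert (h : IsStarPathPartition G c) {v : V} (hv : IsLeafVert G v) :
    c v = .leaf ∨ c v = .support := by
  obtain ⟨u, hu, huniq⟩ := hv
  have h3 := h.middle v
  have h4 := h.arm v
  cases hc : c v <;> grind

theorem isLeafVert (h : IsStarPathPartition G c) {v : V} (hv : c v = .leaf) :
    IsLeafVert G v := by
  obtain ⟨s, -, hs, hs'⟩ := h.leaf v hv
  exact ⟨s, hs, hs'⟩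

theorem isSupportVert (h : IsStarPathPartition G c) {v : V} (hv : c v = .support) :
    IsSupportVert G v := by
  obtain ⟨l, hl, hvl⟩ := h.support v hv
  exact ⟨l, hvl, h.isLeafVert hl⟩

theorem not_isLeafVert_of_adj_arm (h : IsStarPathPartition G c) {a v : V} (ha : c a = .arm)
    (hav : G.Adj a v) : ¬ IsLeafVert G v := by
  intro hv
  have h1 := h.leaf v
  have h2 := h.support v
  have := hav.symm
  rcases h.role_of_isLeafVert hv with hc | hc
  · grind
  · obtain ⟨u, hu, huniq⟩ := hv
    grind

theorem isSemiSupportVert (h : IsStarPathPartition G c) {a v : V} (ha : c a = .arm)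
    (hv : c v = .support) (hav : G.Adj a v) : IsSemiSupportVert G a := by
  refine ⟨fun hl => ?_, ?_, v, hav, h.isSupportVert hv⟩
  · rcases h.role_of_isLeafVert hl with hc | hc <;> simp [ha] at hc
  · rintro ⟨u, hu, hl⟩
    exact h.not_isLeafVert_of_adj_arm ha hu hl

theorem isWeakLeaf (h : IsStarPathPartition G c) {y z : V} (hy : c y = .leaf)
    (hyz : G.Adj y z) (hz : ∀ b, G.Adj z b → c b = .leaf → b = y) : IsWeakLeaf G y := by
  refine ⟨h.isLeafVert hy, ?_⟩
  obtain ⟨s, hs, hys, hs'⟩ := h.leaf y hy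
  rintro ⟨-, s', hys', l₁, l₂, hne, h₁, h₂, hl₁, hl₂⟩
  obtain ⟨l, hly, hzl, hl⟩ : ∃ l, l ≠ y ∧ G.Adj z l ∧ IsLeafVert G l := by grind
  have hcl := h.role_of_isLeafVert hl
  obtain ⟨t, ht, htu⟩ := hl
  have := h.support l
  have := hzl.symm
  grind

/-- Removing one of two leaves of a support vertex. -/
theorem induce_of_two_leaves (h : IsStarPathPartition G c) {S : Set V} {v l₁ l₂ : V}
    (hS : ∀ b, b ∈ S ↔ b ≠ l₁) (hl₁ : c l₁ = .leaf)
    (hl₂ : c l₂ = .leaf) (hne : l₁ ≠ l₂) (hv₁ : G.Adj v l₁) (hv₂ : G.Adj v l₂) :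
    IsStarPathPartition (G.induce S) (fun w => c w) := by
  have hadj : ∀ {a b}, G.Adj a b → G.Adj b a := fun h => h.symm
  obtain ⟨s, hs, hls, hs'⟩ := h.leaf l₁ hl₁
  constructor
  · rintro ⟨w, hw⟩ hcw
    obtain ⟨t, ht, hwt, ht'⟩ := h.leaf w hcw
    exact ⟨⟨t, by grind⟩, ht, hwt, fun b hb => Subtype.ext (ht' b hb)⟩
  · rintro ⟨w, hw⟩ hcw
    obtain ⟨l, hl, hwl⟩ := h.support w hcw
    by_cases hl' : l = l₁
    · exact ⟨⟨l₂, by grind⟩, hl₂, by simp; grind⟩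
    · exact ⟨⟨l, by grind⟩, hl, hwl⟩
  · rintro ⟨w, hw⟩ hcw
    obtain ⟨x, z, hxz, hx, hz, hwx, hwz, hxz'⟩ := h.middle w hcw
    exact ⟨⟨x, by grind⟩, ⟨z, by grind⟩, by simpa using hxz, hx, hz, hwx, hwz,
      fun b hb => (hxz' b hb).imp Subtype.ext Subtype.ext⟩
  · rintro ⟨w, hw⟩ hcw
    obtain ⟨m, hm, hwm, hm', b, hb, hwb⟩ := h.arm w hcw
    exact ⟨⟨m, by grind⟩, hm, hwm, fun m' h₁ h₂ => Subtype.ext (hm' m' h₁ h₂), ⟨b, by grind⟩,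
      by simpa using hb, hwb⟩

/-- Removing a star with a single leaf whose support vertex has degree two. -/
theorem induce_of_star (h : IsStarPathPartition G c) {S : Set V} {u v w : V}
    (hS : ∀ b, b ∈ S ↔ b ≠ v ∧ b ≠ u) (hu : c u = .leaf) (hvu : G.Adj v u)
    (hv : ∀ b, G.Adj v b → b = u ∨ b = w)
    (hw : c w = .support ∨ ∃ v', v' ≠ v ∧ c v' = .support ∧ G.Adj w v') :
    IsStarPathPartition (G.induce S) (fun w => c w) := by
  have hadj : ∀ {a b}, G.Adj a b → G.Adj b a := fun h => h.symm
  obtain ⟨s, hs, hus, hs'⟩ := h.leaf u hu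
  constructor
  · rintro ⟨a, ha⟩ hca
    obtain ⟨t, ht, hat, ht'⟩ := h.leaf a hca
    have hw' := h.leaf w
    exact ⟨⟨t, by grind⟩, ht, hat, fun b hb => Subtype.ext (ht' b hb)⟩
  · rintro ⟨a, ha⟩ hca
    obtain ⟨l, hl, hal⟩ := h.support a hca
    exact ⟨⟨l, by grind⟩, hl, hal⟩
  · rintro ⟨a, ha⟩ hca
    obtain ⟨x, z, hxz, hx, hz, hwx, hwz, hxz'⟩ := h.middle a hca
    exact ⟨⟨x, by grind⟩, ⟨z, by grind⟩, by simpa using hxz, hx, hz, hwx, hwz,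
      fun b hb => (hxz' b hb).imp Subtype.ext Subtype.ext⟩
  · rintro ⟨a, ha⟩ hca
    obtain ⟨m, hm, ham, hm', b, hb, hab⟩ := h.arm a hca
    refine ⟨⟨m, by grind⟩, hm, ham, fun m' h₁ h₂ => Subtype.ext (hm' m' h₁ h₂), ?_⟩
    by_cases hbv : b = v
    · obtain ⟨v', hv', hcv', hwv'⟩ : ∃ v', v' ≠ v ∧ c v' = .support ∧ G.Adj w v' := by grind
      refine ⟨⟨v', by grind⟩, by simp; grind, by simp; grind⟩
    · exact ⟨⟨b, by grind⟩, by simpa using hb, hab⟩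

open Classical in
/-- Removing a star with a single leaf and an adjacent arm `x` of degree two; the rest of the
path through `x` becomes a star. -/
theorem induce_of_star_arm (h : IsStarPathPartition G c) {S : Set V} {u v x y z : V}
    (hS : ∀ b, b ∈ S ↔ b ≠ x ∧ b ≠ v ∧ b ≠ u) (hu : c u = .leaf)
    (hvu : G.Adj v u) (hv : ∀ b, G.Adj v b → b = u ∨ b = x)
    (hx : ∀ b, G.Adj x b → b = v ∨ b = y) (hcx : c x = .arm) (hcz : c z = .arm)
    (hcy : c y = .middle) (hxz : x ≠ z) (hyx : G.Adj y x) (hyz : G.Adj y z)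
    (hy : ∀ b, G.Adj y b → b = x ∨ b = z) :
    IsStarPathPartition (G.induce S)
      (fun w => if w.1 = y then .leaf else if w.1 = z then .support else c w) := by
  have hadj : ∀ {a b}, G.Adj a b → G.Adj b a := fun h => h.symm
  obtain ⟨s, hs, hus, hs'⟩ := h.leaf u hu
  have hzM : ∀ m, c m = .middle → G.Adj z m → m = y := by
    obtain ⟨m, hm, -, hm', -⟩ := h.arm z hcz
    grind
  constructor
  · rintro ⟨a, ha⟩ hca
    by_cases hay : a = y
    · subst hay
      refine ⟨⟨z, by grind⟩, by grind, hyz, ?_⟩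
      rintro ⟨b, hb⟩ hab
      have := hy b hab
      simp
      grind
    · have haz : a ≠ z := by grind
      simp only [hay, haz, if_false] at hca
      obtain ⟨t, ht, hat, ht'⟩ := h.leaf a hca
      exact ⟨⟨t, by grind⟩, by grind, hat, fun b hb => Subtype.ext (ht' b hb)⟩
  · rintro ⟨a, ha⟩ hca
    by_cases haz : a = z
    · exact ⟨⟨y, by grind⟩, by grind, by simp; grind⟩
    · have hay : a ≠ y := by grind
      simp only [hay, haz, if_false] at hca
      obtain ⟨l, hl, hal⟩ := h.support a hca
      exact ⟨⟨l, by grind⟩, by grind, hal⟩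
  · rintro ⟨a, ha⟩ hca
    have hay : a ≠ y := by grind
    have haz : a ≠ z := by grind
    simp only [hay, haz, if_false] at hca
    obtain ⟨p, q, hpq, hp, hq, hap, haq, hpq'⟩ := h.middle a hca
    exact ⟨⟨p, by grind⟩, ⟨q, by grind⟩, by simpa using hpq, by grind, by grind, hap, haq,
      fun b hb => (hpq' b hb).imp Subtype.ext Subtype.ext⟩
  · rintro ⟨a, ha⟩ hca
    have hay : a ≠ y := by grind
    have haz : a ≠ z := by grind
    simp only [hay, haz, if_false] at hca
    obtain ⟨m, hm, ham, hm', b, hb, hab⟩ := h.arm a hca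
    have hmx : m ≠ y := by grind
    exact ⟨⟨m, by grind⟩, by grind, ham,
      fun m' h₁ h₂ => Subtype.ext (hm' m' (by grind) h₂),
      ⟨b, by grind⟩, by simpa using hb, hab⟩

end IsStarPathPartition

/-- A tree with a star-path partition in which no support vertex has two leaves is `P₂`, or has a
support vertex `v` of degree two with a leaf `u` and another neighbor `w` such that either `w` is
a support vertex, or `w` is an arm with another support neighbor, or `w` is an arm of degree
two. -/
theorem IsStarPathPartition.exists_end {V : Type u} [Finite V] {G : SimpleGraph V}
    {c : V → VertexRole} (h : IsStarPathPartition G c) (hG : G.IsTree)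
    (hone : ∀ v l₁ l₂, c l₁ = .leaf → c l₂ = .leaf → G.Adj v l₁ → G.Adj v l₂ → l₁ = l₂) :
    (∃ a b, G.Adj a b ∧ ∀ w, w = a ∨ w = b) ∨
    ∃ u v w, c u = .leaf ∧ c v = .support ∧ u ≠ w ∧ G.Adj v u ∧ G.Adj v w ∧
      (∀ b, G.Adj v b → b = u ∨ b = w) ∧
      (c w = .support ∨ c w = .arm ∧ ((∃ v', v' ≠ v ∧ c v' = .support ∧ G.Adj w v') ∨
        ∃ y, c y = .middle ∧ G.Adj w y ∧ ∀ b, G.Adj w b → b = v ∨ b = y)) := by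
  have hadj : ∀ {a b}, G.Adj a b → G.Adj b a := fun h => h.symm
  have : Nonempty V := hG.connected.nonempty
  let r : V := Classical.arbitrary V
  let d : V → ℕ := G.dist r
  have hd : ∀ {a b}, G.Adj a b → d a = d b + 1 ∨ d b = d a + 1 :=
    fun hab => hG.dist_eq_dist_add_one_of_adj r hab
  have hpar : ∀ {a b b'}, G.Adj a b → G.Adj a b' → d b < d a → d b' < d a → b = b' :=
    fun hab hac => eq_of_adj_of_dist_lt hG r hab hac
  clear_value d
  obtain ⟨u, hu⟩ := Finite.exists_max d
  have hdeep : ∀ {a b b'}, d a = d u → G.Adj a b → G.Adj a b' → b = b' := by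
    intro a b b' ha hab hab'
    refine hpar hab hab' ?_ ?_
    · have := hd hab
      have := hu b
      omega
    · have := hd hab'
      have := hu b'
      omega
  have hdeep_role : ∀ {a}, d a = d u → c a = .leaf ∨ c a = .support := by
    intro a ha
    obtain ⟨b, hab⟩ := h.exists_adj a
    exact h.role_of_isLeafVert ⟨b, hab, fun b' hab' => hdeep ha hab' hab⟩
  have pair : ∀ {a b}, G.Adj a b → (∀ b', G.Adj a b' → b' = b) → (∀ a', G.Adj b a' → a' = a) →
      ∀ w, w = a ∨ w = b := by
    intro a b _ ha hb
    refine mem_of_closed hG.connected (S := {w | w = a ∨ w = b}) (v := a) (Or.inl rfl) ?_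
    rintro x (rfl | rfl) y hxy
    · exact Or.inr (ha y hxy)
    · exact Or.inl (hb y hxy)
  obtain ⟨v, huv⟩ := h.exists_adj u
  have hu1 : ∀ b, G.Adj u b → b = v := fun b hb => hdeep rfl hb huv
  by_cases hv1 : ∀ b, G.Adj v b → b = u
  · exact Or.inl ⟨u, v, huv, pair huv hu1 hv1⟩
  push Not at hv1
  obtain ⟨w, hvw, hwu⟩ := hv1
  have hcu : c u = .leaf := by
    refine (hdeep_role rfl).resolve_right fun hs => ?_
    obtain ⟨l, hl, hul⟩ := h.support u hs
    obtain rfl := hu1 l hul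
    obtain ⟨s, -, hls, hs'⟩ := h.leaf l hl
    exact hwu ((hs' w hvw).trans (hs' u huv.symm).symm)
  have hcv : c v = .support := by
    obtain ⟨s, hs, hus, -⟩ := h.leaf u hcu
    rwa [← hu1 s hus]
  have hdu : d u = d v + 1 := by
    have := hd huv
    have := hu v
    omega
  have hchild : ∀ b, G.Adj v b → d b = d u → b = u := by
    intro b hvb hb
    have hcb : c b = .leaf := by
      refine (hdeep_role hb).resolve_right fun hs => ?_
      obtain ⟨l, hl, hbl⟩ := h.support b hs
      rw [hdeep hb hbl hvb.symm, hcv] at hl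
      cases hl
    exact hone v b u hcb hcu hvb huv.symm
  have hdw : d v = d w + 1 := by
    rcases hd hvw with h1 | h1
    · exact h1
    · exact absurd (hchild w hvw (by omega)) hwu
  have hv2 : ∀ b, G.Adj v b → b = u ∨ b = w := by
    intro b hvb
    rcases hd hvb with h1 | h1
    · exact Or.inr (hpar hvb hvw (by omega) (by omega))
    · exact Or.inl (hchild b hvb (by omega))
  refine Or.inr ⟨u, v, w, hcu, hcv, hwu.symm, huv.symm, hvw, hv2, ?_⟩
  have hw_child : ∀ b, c w = .arm → G.Adj w b → d b = d w + 1 → c b = .support := by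
    intro b hcw hwb hb
    have key : ∀ x, x ≠ w → G.Adj b x → c x = .leaf ∨ c x = .support := by
      intro x hxw hbx
      refine hdeep_role ?_
      rcases hd hbx with h1 | h1
      · exact absurd (hpar hbx hwb.symm (by omega) (by omega)) hxw
      · omega
    have h3 := h.middle b
    have h4 := h.arm b
    cases hcb : c b with
    | leaf =>
      obtain ⟨t, ht, -, ht'⟩ := h.leaf b hcb
      rw [← ht' w hwb.symm, hcw] at ht
      cases ht
    | support => rfl
    | middle =>
      obtain ⟨x, z, hxz, hx, hz, hbx, hbz, -⟩ := h3 hcb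
      grind
    | arm =>
      obtain ⟨m, hm, hbm, -⟩ := h4 hcb
      have hmw : m ≠ w := fun e => by simp [← e, hm] at hcw
      rcases key m hmw hbm with h5 | h5 <;> simp [hm] at h5
  cases hcw : c w with
  | support => exact Or.inl rfl
  | leaf => exact absurd (hone v w u hcw hcu hvw huv.symm) hwu
  | middle =>
    obtain ⟨x, z, hxz, hx, hz, -, -, hxz'⟩ := h.middle w hcw
    grind
  | arm =>
    refine Or.inr ⟨rfl, ?_⟩
    by_cases hv' : ∃ v', v' ≠ v ∧ c v' = .support ∧ G.Adj w v'
    · exact Or.inl hv'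
    obtain ⟨y, hy, hwy, hy', -⟩ := h.arm w hcw
    refine Or.inr ⟨y, hy, hwy, fun b hwb => ?_⟩
    have hyw : d w = d y + 1 := by
      refine (hd hwy).resolve_right fun h5 => ?_
      rw [hw_child y hcw hwy h5] at hy
      cases hy
    rcases hd hwb with h5 | h5
    · exact Or.inr (hpar hwb hwy (by omega) (by omega))
    · by_contra! hb
      exact hv' ⟨b, hb.1, hw_child b hcw hwb h5, hwb⟩

/-- A finite tree with a star-path partition belongs to the family `F`. -/
theorem IsStarPathPartition.inFamilyF {V : Type u} [Finite V] {G : SimpleGraph V}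
    {c : V → VertexRole} (h : IsStarPathPartition G c) (hG : G.IsTree) : InFamilyF G := by
  induction hn : Nat.card V using Nat.strong_induction_on generalizing V with
  | _ n ih =>
    have hadj : ∀ {a b}, G.Adj a b → G.Adj b a := fun h => h.symm
    have hirr : ∀ a, ¬ G.Adj a a := fun a => G.loopless.irrefl a
    have step : ∀ {r : ℕ} (p : Fin r → V) (x : Fin r) {v : V} (hv : v ∈ (Set.range p)ᶜ)
        {c' : ↥(Set.range p)ᶜ → VertexRole}, IsStarPathPartition (G.induce (Set.range p)ᶜ) c' →
        (∀ s ∉ Set.range p, ∀ i, G.Adj s (p i) ↔ s = v ∧ (i : ℕ) = 0) →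
        InFamilyF (G.induce (Set.range p)ᶜ) := by
      intro r p x v hv c' h' hsp
      refine ih _ (hn ▸ Finite.card_subtype_lt (x := p x) (by simp)) h'
        (isTree_induce_of_cut hG hv fun s hs t ht hst => ?_) rfl
      obtain ⟨i, rfl⟩ := not_not.1 ht
      exact ((hsp s hs i).1 hst).1
    by_cases htwo : ∃ v l₁ l₂, c l₁ = .leaf ∧ c l₂ = .leaf ∧ G.Adj v l₁ ∧ G.Adj v l₂ ∧ l₁ ≠ l₂
    · obtain ⟨v, l₁, l₂, hl₁, hl₂, hv₁, hv₂, hne⟩ := htwo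
      obtain ⟨s, hs, hls, hs'⟩ := h.leaf l₁ hl₁
      obtain rfl := hs' v hv₁.symm
      let p : Fin 1 → V := ![l₁]
      have hS : ∀ b, b ∈ (Set.range p)ᶜ ↔ b ≠ l₁ := by simp [p]
      have hvS : v ∈ (Set.range p)ᶜ := (hS v).2 hv₁.ne
      have h' := h.induce_of_two_leaves hS hl₁ hl₂ hne hv₁ hv₂
      have hsp : ∀ s ∉ Set.range p, ∀ i, G.Adj s (p i) ↔ s = v ∧ (i : ℕ) = 0 := by
        simp [p]
        grind
      obtain ⟨e⟩ := nonempty_iso_attachPath (G := G) p (by simp [p, Function.Injective]) hvS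
        (by simp [p]) hsp
      exact .op1 (h'.isSupportVert (v := ⟨v, hvS⟩) hs)
        (step p 0 hvS h' hsp) G e
    · push Not at htwo
      rcases h.exists_end hG (fun v l₁ l₂ => htwo v l₁ l₂) with
        ⟨a, b, hab, hw⟩ | ⟨u, v, w, hu, hv, huw, hvu, hvw, hv2, hw⟩
      · exact inFamilyF_of_pair hab hw
      have hu1 : ∀ b, G.Adj u b → b = v := by
        obtain ⟨s, hs, hus, hs'⟩ := h.leaf u hu
        intro b hb
        rw [hs' b hb, hs' v hvu.symm]
      have huv : u ≠ v := hvu.ne'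
      have hwv : w ≠ v := hvw.ne'
      by_cases hw2 : c w = .support ∨ c w = .arm ∧ ∃ v', v' ≠ v ∧ c v' = .support ∧ G.Adj w v'
      · let p : Fin 2 → V := ![v, u]
        have hS : ∀ b, b ∈ (Set.range p)ᶜ ↔ b ≠ v ∧ b ≠ u := by simp [p, and_comm]
        have hwS : w ∈ (Set.range p)ᶜ := (hS w).2 ⟨hwv, huw.symm⟩
        have h' := h.induce_of_star hS hu hvu hv2 (hw2.imp_right And.right)
        have hsp : ∀ s ∉ Set.range p, ∀ i, G.Adj s (p i) ↔ s = w ∧ (i : ℕ) = 0 := by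
          simp only [Set.mem_range, Fin.exists_fin_two, Fin.forall_fin_two, p]
          simp
          grind
        obtain ⟨e⟩ := nonempty_iso_attachPath (G := G) p
          (by simp [p, Function.Injective, Fin.forall_fin_two]; grind) hwS
          (by simp [p, Fin.forall_fin_two]; grind) hsp
        refine .op2 (v := ⟨w, hwS⟩) ?_
          (step p 0 hwS h' hsp) G e
        rcases hw2 with hw2 | ⟨hcw, v', hv', hcv', hwv'⟩
        · exact .inl (h'.isSupportVert hw2)
        · exact .inr (h'.isSemiSupportVert (v := ⟨v', (hS v').2 ⟨hv', by grind⟩⟩) hcw hcv' hwv')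
      · obtain ⟨hcw, y, hcy, hwy, hw1⟩ : c w = .arm ∧
            ∃ y, c y = .middle ∧ G.Adj w y ∧ ∀ b, G.Adj w b → b = v ∨ b = y := by
          rcases hw with hw | ⟨hcw, hw | hw⟩
          · exact absurd (.inl hw) hw2
          · exact absurd (.inr ⟨hcw, hw⟩) hw2
          · exact ⟨hcw, hw⟩
        obtain ⟨z, hcz, hwz, hyz, hy2⟩ : ∃ z, c z = .arm ∧ w ≠ z ∧ G.Adj y z ∧
            ∀ b, G.Adj y b → b = w ∨ b = z := by
          obtain ⟨x, z, hxz, hx, hz, hyx, hyz, hy2⟩ := h.middle y hcy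
          rcases hy2 w hwy.symm with rfl | rfl
          · exact ⟨z, hz, hxz, hyz, hy2⟩
          · exact ⟨x, hx, hxz.symm, hyx, fun b hb => (hy2 b hb).symm⟩
        let p : Fin 3 → V := ![w, v, u]
        have hS : ∀ b, b ∈ (Set.range p)ᶜ ↔ b ≠ w ∧ b ≠ v ∧ b ≠ u := by
          simp [p]
          tauto
        have hyS : y ∈ (Set.range p)ᶜ := (hS y).2 ⟨hwy.ne', by grind, by grind⟩
        have hzS : z ∈ (Set.range p)ᶜ := (hS z).2 ⟨hwz.symm, by grind, by grind⟩
        have h' := h.induce_of_star_arm hS hu hvu hv2 hw1 hcw hcz hcy hwz hwy.symm hyz hy2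
        have hsp : ∀ s ∉ Set.range p, ∀ i, G.Adj s (p i) ↔ s = y ∧ (i : ℕ) = 0 := by
          simp [p, Fin.forall_fin_succ]
          grind
        obtain ⟨e⟩ := nonempty_iso_attachPath (G := G) p
          (by simp [p, Function.Injective, Fin.forall_fin_succ]; grind) hyS
          (by simp [p, Fin.forall_fin_succ]; grind) hsp
        refine .op3 (v := ⟨y, hyS⟩) ?_
          (step p 0 hyS h' hsp) G e
        refine h'.isWeakLeaf (z := ⟨z, hzS⟩) (by simp) hyz ?_
        rintro ⟨b, hb⟩ hzb hcb
        have hlz := h.leaf b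
        have : G.Adj z b := hzb
        grind

/-- If the weights of the two orientations of every edge add up to `k`, then the weights of all
darts add up to `k` times the number of edges. -/
theorem sum_sum_neighborFinset_eq {V : Type u} [Fintype V] (H : SimpleGraph V)
    [DecidableRel H.Adj] (f : V → V → ℤ) (k : ℤ)
    (hf : ∀ a b, H.Adj a b → f a b + f b a = k) :
    ∑ v, ∑ b ∈ H.neighborFinset v, f v b = k * H.edgeFinset.card := by
  have hswap : ∑ v, ∑ b ∈ H.neighborFinset v, f v b = ∑ v, ∑ b ∈ H.neighborFinset v, f b v := by
    simp only [neighborFinset_eq_filter, Finset.sum_filter]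
    rw [Finset.sum_comm]
    simp only [H.adj_comm]
  have hdouble : ∑ v, ∑ b ∈ H.neighborFinset v, f v b + ∑ v, ∑ b ∈ H.neighborFinset v, f b v
      = k * (2 * H.edgeFinset.card : ℕ) := by
    rw [← H.sum_degrees_eq_twice_card_edges, ← Finset.sum_add_distrib, Nat.cast_sum,
      Finset.mul_sum]
    refine Finset.sum_congr rfl fun v _ => ?_
    rw [← Finset.sum_add_distrib, Finset.sum_congr rfl fun b hb => hf v b (by simpa using hb)]
    simp [mul_comm]
  push_cast at hdouble
  linarith

open Classical in
/-- The charge which the edge `ab` gives to its endpoint `a`; here `A` is the set of original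
vertices belonging to a given total outer-independent dominating set of the subdivision graph. -/
noncomputable def charge {V : Type u} (G : SimpleGraph V) (A : Set V) (a b : V) : ℤ :=
  if a ∈ A then if b ∈ A then 3 else if IsLeafVert G b then 0 else 2
  else if IsLeafVert G a then 6 else 4

open Classical in
/-- The charge of a vertex after discharging. -/
noncomputable def finalCharge {V : Type u} [Fintype V] (G H : SimpleGraph V) (A : Set V)
    (v : V) : ℤ :=
  ∑ b ∈ H.neighborFinset v, charge G A v b + (if IsLeafVert G v then 2 else 0) +
    (if IsSupportVert G v then 2 else 0) - 2 - (if v ∈ A then 0 else 6)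

/-- The properties of the traces on `V(G)` and on `E(G)` of a total outer-independent dominating
set of the subdivision graph of `G`. -/
structure IsTOIDSTrace {V : Type u} (G H : SimpleGraph V) (A : Set V) : Prop where
  le : H ≤ G
  exists_adj : ∀ v, ∃ b, H.Adj v b
  mem : ∀ v ∉ A, ∀ b, G.Adj v b → b ∈ A
  adj : ∀ v ∉ A, ∀ b, G.Adj v b → H.Adj v b

namespace IsTOIDSTrace

variable {V : Type u} {G H : SimpleGraph V} {A : Set V}

theorem charge_nonneg (a b : V) : 0 ≤ charge G A a b := by
  unfold charge
  split_ifs <;> norm_num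

theorem charge_add_charge (h : IsTOIDSTrace G H A) {a b : V} (hab : H.Adj a b) :
    charge G A a b + charge G A b a = 6 := by
  have h1 := h.le hab
  have h2 := h.mem a
  unfold charge
  grind

variable [Fintype V]

theorem sum_finalCharge (h : IsTOIDSTrace G H A) :
    ∑ v, finalCharge G H A v = 6 * (H.edgeSet.ncard + A.ncard) - 8 * Nat.card V
      + 2 * {v | IsLeafVert G v}.ncard + 2 * {v | IsSupportVert G v}.ncard := by
  classical
  have hind : ∀ (P : V → Prop) (k : ℤ), ∑ v, (if P v then k else 0) = k * {v | P v}.ncard := by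
    intro P k
    simp [Finset.sum_ite, Set.ncard_eq_toFinset_card', mul_comm]
  have hA : ∑ v, (if v ∈ A then 0 else 6 : ℤ) = 6 * (Nat.card V - A.ncard) := by
    have : ∀ v, (if v ∈ A then 0 else 6 : ℤ) = 6 - if v ∈ A then 6 else 0 := by
      intro v
      split_ifs <;> rfl
    simp only [this, Finset.sum_sub_distrib, hind, Set.ofPred_mem_eq]
    simp
    ring
  simp only [finalCharge, Finset.sum_sub_distrib, Finset.sum_add_distrib, hA, hind]
  rw [sum_sum_neighborFinset_eq H _ 6 fun a b hab => h.charge_add_charge hab,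
    Set.ncard_eq_toFinset_card' H.edgeSet]
  simp [SimpleGraph.edgeFinset]
  ring

open Classical in
theorem finalCharge_of_notMem (h : IsTOIDSTrace G H A) {v : V} (hvA : v ∉ A) :
    0 ≤ finalCharge G H A v ∧ (finalCharge G H A v = 0 → ¬ IsLeafVert G v →
      ¬ IsSupportVert G v ∧ (H.neighborFinset v).card = 2) := by
  obtain ⟨b, hb⟩ := h.exists_adj v
  have hcard : 1 ≤ (H.neighborFinset v).card := Finset.card_pos.2 ⟨b, by simpa⟩
  have hcard' : ¬ IsLeafVert G v → 2 ≤ (H.neighborFinset v).card := by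
    intro hv
    obtain ⟨b', hb', hne⟩ : ∃ b', G.Adj v b' ∧ b' ≠ b := by
      by_contra! hb'
      exact hv ⟨b, h.le hb, hb'⟩
    exact Finset.one_lt_card.2 ⟨b, by simpa, b', by simpa using h.adj v hvA b' hb', hne.symm⟩
  simp only [finalCharge, charge, hvA, if_false, Finset.sum_const, nsmul_eq_mul]
  by_cases hv : IsLeafVert G v <;> by_cases hs : IsSupportVert G v <;>
    simp only [hv, hs, if_true, if_false, not_true, not_false_iff, true_and, false_and,
      forall_true_left] at hcard' ⊢ <;> grind

theorem finalCharge_of_mem {v : V} (hvA : v ∈ A)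
    (hv : IsLeafVert G v ∨ IsSupportVert G v) :
    0 ≤ finalCharge G H A v ∧ (finalCharge G H A v = 0 →
      ∀ b, H.Adj v b → b ∉ A ∧ IsLeafVert G b) := by
  classical
  have hnn := fun b (_ : b ∈ H.neighborFinset v) => charge_nonneg (G := G) (A := A) v b
  have hsum := Finset.sum_nonneg hnn
  have hle : ∑ b ∈ H.neighborFinset v, charge G A v b ≤ finalCharge G H A v := by
    simp only [finalCharge, hvA, if_true]
    split_ifs <;> first | omega | tauto
  refine ⟨hsum.trans hle, fun h0 b hb => ?_⟩
  have := (Finset.sum_eq_zero_iff_of_nonneg hnn).1 (le_antisymm (hle.trans h0.le) hsum) b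
    (by simpa)
  simp only [charge, hvA, if_true] at this
  grind

theorem finalCharge_of_mem_of_not (h : IsTOIDSTrace G H A) {v : V} (hvA : v ∈ A)
    (hl : ¬ IsLeafVert G v) (hs : ¬ IsSupportVert G v) :
    0 ≤ finalCharge G H A v ∧ (finalCharge G H A v = 0 →
      ∃ m ∉ A, H.Adj v m ∧ ∀ b, H.Adj v b → b = m) := by
  classical
  have htwo : ∀ b ∈ H.neighborFinset v, 2 ≤ charge G A v b := by
    intro b hb
    have hb' : ¬ IsLeafVert G b := fun hb' => hs ⟨b, h.le (by simpa using hb), hb'⟩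
    simp only [charge, hvA, hb', if_true, if_false]
    split_ifs <;> norm_num
  obtain ⟨m, hm⟩ := h.exists_adj v
  have hmem : m ∈ H.neighborFinset v := by simpa
  have hcard : 1 ≤ (H.neighborFinset v).card := Finset.card_pos.2 ⟨m, hmem⟩
  have hsum : (H.neighborFinset v).card * 2 ≤ ∑ b ∈ H.neighborFinset v, charge G A v b := by
    simpa using Finset.card_nsmul_le_sum _ _ 2 htwo
  have heq : finalCharge G H A v = ∑ b ∈ H.neighborFinset v, charge G A v b - 2 := by
    simp [finalCharge, hvA, hl, hs]
  refine ⟨by omega, fun h0 => ?_⟩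
  have huniq : ∀ b, H.Adj v b → b = m := fun b hb =>
    Finset.card_le_one.1 (by omega) b (by simpa) m hmem
  refine ⟨m, fun hmA => ?_, hm, huniq⟩
  have hN : H.neighborFinset v = {m} :=
    Finset.eq_singleton_iff_unique_mem.2 ⟨hmem, fun b hb => huniq b (by simpa using hb)⟩
  rw [heq, hN, Finset.sum_singleton] at h0
  simp [charge, hvA, hmA] at h0

theorem finalCharge_nonneg (h : IsTOIDSTrace G H A) (v : V) : 0 ≤ finalCharge G H A v := by
  by_cases hvA : v ∈ A
  · by_cases hv : IsLeafVert G v ∨ IsSupportVert G v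
    · exact (finalCharge_of_mem hvA hv).1
    · push Not at hv
      exact (h.finalCharge_of_mem_of_not hvA hv.1 hv.2).1
  · exact (h.finalCharge_of_notMem hvA).1

theorem exists_isStarPathPartition (h : IsTOIDSTrace G H A)
    (hLS : ∀ v, IsLeafVert G v → ¬ IsSupportVert G v)
    (hcount : 6 * (H.edgeSet.ncard + A.ncard) + 2 * {v | IsLeafVert G v}.ncard
      + 2 * {v | IsSupportVert G v}.ncard = 8 * Nat.card V) :
    ∃ c, IsStarPathPartition G c := by
  classical
  have hadj : ∀ {a b}, G.Adj a b → G.Adj b a := fun h => h.symm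
  have h0 : ∀ v, finalCharge G H A v = 0 := by
    have hsum : ∑ v, finalCharge G H A v = 0 := by
      rw [h.sum_finalCharge]
      omega
    intro v
    exact (Finset.sum_eq_zero_iff_of_nonneg fun v _ => h.finalCharge_nonneg v).1 hsum v
      (Finset.mem_univ v)
  have hdeg2 : ∀ v ∉ A, ¬ IsLeafVert G v → ¬ IsSupportVert G v ∧ ∃ x z, x ≠ z ∧ G.Adj v x ∧
      G.Adj v z ∧ ∀ w, G.Adj v w → w = x ∨ w = z := by
    intro v hvA hv
    obtain ⟨hs, hcard⟩ := (h.finalCharge_of_notMem hvA).2 (h0 v) hv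
    obtain ⟨x, z, hxz, hN⟩ := Finset.card_eq_two.1 hcard
    have hN' : ∀ w, H.Adj v w ↔ w = x ∨ w = z := by
      intro w
      rw [← mem_neighborFinset, hN]
      simp
    exact ⟨hs, x, z, hxz, h.le ((hN' x).2 (.inl rfl)), h.le ((hN' z).2 (.inr rfl)),
      fun w hw => (hN' w).1 (h.adj v hvA w hw)⟩
  have hstar : ∀ v ∈ A, IsLeafVert G v ∨ IsSupportVert G v → ∀ b, H.Adj v b →
      IsLeafVert G b := fun v hvA hv b hb => ((finalCharge_of_mem hvA hv).2 (h0 v) b hb).2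
  have hL : ∀ v, IsLeafVert G v → v ∉ A := by
    intro v hv hvA
    obtain ⟨b, hb⟩ := h.exists_adj v
    exact hLS v hv ⟨b, h.le hb, hstar v hvA (.inl hv) b hb⟩
  have hS : ∀ v ∉ A, ¬ IsSupportVert G v := by
    intro v hvA
    by_cases hv : IsLeafVert G v
    · exact hLS v hv
    · exact (hdeg2 v hvA hv).1
  have harm : ∀ v ∉ A, ¬ IsLeafVert G v → ∀ w, G.Adj v w →
      w ∈ A ∧ ¬ IsLeafVert G w ∧ ¬ IsSupportVert G w := by
    intro v hvA hv w hw
    have hwA := h.mem v hvA w hw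
    exact ⟨hwA, fun hl => hL w hl hwA,
      fun hs => hv (hstar w hwA (.inr hs) v (h.adj v hvA w hw).symm)⟩
  let c : V → VertexRole := fun v => if IsLeafVert G v then .leaf
    else if IsSupportVert G v then .support else if v ∈ A then .arm else .middle
  have hcl : ∀ v, c v = .leaf ↔ IsLeafVert G v := by grind
  have hcs : ∀ v, c v = .support ↔ IsSupportVert G v := by grind
  have hcm : ∀ v, c v = .middle ↔ v ∉ A ∧ ¬ IsLeafVert G v := by grind
  have hca : ∀ v, c v = .arm ↔ v ∈ A ∧ ¬ IsLeafVert G v ∧ ¬ IsSupportVert G v := by grind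
  refine ⟨c, ?_, ?_, ?_, ?_⟩
  · intro v hv
    rw [hcl] at hv
    obtain ⟨s, hs, hs'⟩ := id hv
    exact ⟨s, (hcs s).2 ⟨v, hs.symm, hv⟩, hs, hs'⟩
  · intro v hv
    obtain ⟨l, hvl, hl⟩ := (hcs v).1 hv
    exact ⟨l, (hcl l).2 hl, hvl⟩
  · intro v hv
    obtain ⟨hvA, hv⟩ := (hcm v).1 hv
    obtain ⟨-, x, z, hxz, hx, hz, hxz'⟩ := hdeg2 v hvA hv
    exact ⟨x, z, hxz, (hca x).2 (harm v hvA hv x hx), (hca z).2 (harm v hvA hv z hz), hx, hz,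
      hxz'⟩
  · intro v hv
    obtain ⟨hvA, hl, hs⟩ := (hca v).1 hv
    obtain ⟨m, hmA, hm, hm'⟩ := (h.finalCharge_of_mem_of_not hvA hl hs).2 (h0 v)
    refine ⟨m, (hcm m).2 ⟨hmA, fun hml => hs ⟨m, h.le hm, hml⟩⟩, h.le hm, ?_, ?_⟩
    · intro m' hcm' hvm'
      exact hm' m' (h.adj m' ((hcm m').1 hcm').1 v hvm'.symm).symm
    · by_contra! hw
      exact hl ⟨m, h.le hm, fun w hvw => by_contra fun hne => hw w hne hvw⟩

end IsTOIDSTrace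

theorem subdivision_adj_inl_inr {V : Type u} (G : SimpleGraph V) (v : V) (e : G.edgeSet) :
    (subdivision G).Adj (.inl v) (.inr e) ↔ v ∈ (e : Sym2 V) := by
  simp [subdivision]

theorem subdivision_not_adj_inl_inl {V : Type u} (G : SimpleGraph V) (v w : V) :
    ¬ (subdivision G).Adj (.inl v) (.inl w) := by
  simp [subdivision]

theorem subdivision_not_adj_inr_inr {V : Type u} (G : SimpleGraph V) (e f : G.edgeSet) :
    ¬ (subdivision G).Adj (.inr e) (.inr f) := by
  simp [subdivision]

/-- The traces of a total outer-independent dominating set of the subdivision graph. -/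
theorem IsTOIDS.exists_isTOIDSTrace {V : Type u} [Finite V] {G : SimpleGraph V}
    {D : Set (V ⊕ G.edgeSet)} (hD : IsTOIDS (subdivision G) D) :
    ∃ H A, IsTOIDSTrace G H A ∧ H.edgeSet.ncard + A.ncard = D.ncard := by
  let E : Set (Sym2 V) := Subtype.val '' (Sum.inr ⁻¹' D)
  have hE : ∀ e ∈ E, e ∈ G.edgeSet := by
    rintro _ ⟨e, -, rfl⟩
    exact e.2
  have hedge : (fromEdgeSet E).edgeSet = E := by
    rw [edgeSet_fromEdgeSet, sdiff_eq_left, Set.disjoint_left]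
    exact fun e he => G.not_isDiag_of_mem_edgeSet (hE e he)
  have hHadj : ∀ a b, (fromEdgeSet E).Adj a b ↔ s(a, b) ∈ E := by
    intro a b
    rw [← mem_edgeSet, hedge]
  refine ⟨fromEdgeSet E, Sum.inl ⁻¹' D, ⟨fun a b hab => hE _ ((hHadj a b).1 hab), ?_, ?_, ?_⟩, ?_⟩
  · intro v
    obtain ⟨w | e, he, hve⟩ := hD.1 (.inl v)
    · exact absurd hve (subdivision_not_adj_inl_inl G v w)
    · rw [subdivision_adj_inl_inr] at hve
      obtain ⟨b, hb⟩ := Sym2.mem_iff_exists.1 hve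
      exact ⟨b, (hHadj v b).2 ⟨e, he, hb⟩⟩
  · intro v hv b hvb
    obtain ⟨w | f, hw, hew⟩ := hD.1 (.inr ⟨s(v, b), hvb⟩)
    · have hwe := (subdivision_adj_inl_inr G w _).1 hew.symm
      rcases Sym2.mem_iff.1 hwe with rfl | rfl
      · exact absurd hw hv
      · exact hw
    · exact absurd hew (subdivision_not_adj_inr_inr G _ f)
  · intro v hv b hvb
    refine (hHadj v b).2 ⟨⟨s(v, b), hvb⟩, by_contra fun he => ?_, rfl⟩
    exact hD.2 _ hv _ he ((subdivision_adj_inl_inr G v _).2 (Sym2.mem_mk_left v b))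
  · rw [hedge, Set.ncard_image_of_injective _ Subtype.val_injective,
      ← Set.ncard_image_of_injective _ Sum.inr_injective,
      ← Set.ncard_image_of_injective (Sum.inl ⁻¹' D) Sum.inl_injective, add_comm,
      ← Set.ncard_union_eq _ (Set.toFinite _) (Set.toFinite _),
      Set.image_preimage_inl_union_image_preimage_inr]
    rw [Set.disjoint_left]
    rintro _ ⟨a, -, rfl⟩ ⟨b, -, h⟩
    cases h

theorem lower_equality_implies_familyF {V : Type u} [Fintype V]
    (T : SimpleGraph V) (hT : T.IsTree) (hn : 2 ≤ Nat.card V)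
    (heq : (toidNumber (subdivision T) : ℚ) = (4 * (Nat.card V : ℚ) - leafCount T - supportCount T) / 3) :
    InFamilyF T := by
  by_cases hLS : ∃ v, IsLeafVert T v ∧ IsSupportVert T v
  · obtain ⟨v, ⟨u, hvu, hu⟩, w, hvw, t, hwt, ht⟩ := hLS
    obtain rfl := hu w hvw
    refine inFamilyF_of_pair hvu (mem_of_closed hT.connected (S := {x | x = v ∨ x = w}) (v := v)
      (.inl rfl) ?_)
    rintro x (rfl | rfl) y hxy
    · exact .inr (hu y hxy)
    · exact .inl ((ht y hxy).trans (ht v hvu.symm).symm)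
  push Not at hLS
  have hn2 : Nat.card V ≠ 2 := by
    intro h2
    obtain ⟨a, b, hab, huniv⟩ := Nat.card_eq_two_iff.1 h2
    have hall : ∀ x, x = a ∨ x = b := fun x => by simpa using Set.eq_univ_iff_forall.1 huniv x
    have : Nontrivial V := ⟨a, b, hab⟩
    have hadj : T.Adj a b := by
      obtain ⟨x, hx⟩ := hT.connected.preconnected.exists_adj_of_nontrivial a
      rcases hall x with rfl | rfl
      · exact absurd rfl hx.ne
      · exact hx
    have hleaf : ∀ x y, T.Adj x y → IsLeafVert T x := by
      intro x y hxy
      refine ⟨y, hxy, fun z hxz => ?_⟩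
      have := hxy.ne
      have := hxz.ne
      rcases hall x with rfl | rfl <;> rcases hall y with rfl | rfl <;>
        rcases hall z with rfl | rfl <;> tauto
    exact hLS a (hleaf a b hadj) ⟨b, hadj, hleaf b a hadj.symm⟩
  simp only [leafCount, supportCount, hn2, if_false] at heq
  have heq' : 3 * toidNumber (subdivision T) + {v | IsLeafVert T v}.ncard
      + {v | IsSupportVert T v}.ncard = 4 * Nat.card V := by
    have : 3 * (toidNumber (subdivision T) : ℚ) + {v | IsLeafVert T v}.ncard
        + {v | IsSupportVert T v}.ncard = 4 * Nat.card V := by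
      rw [heq]
      ring
    exact_mod_cast this
  have hl := Set.ncard_le_card {v | IsLeafVert T v}
  have hs := Set.ncard_le_card {v | IsSupportVert T v}
  obtain ⟨D, hD, hDcard⟩ : ∃ D, IsTOIDS (subdivision T) D ∧
      D.ncard = toidNumber (subdivision T) := by
    have hne : {n : ℕ | ∃ D, IsTOIDS (subdivision T) D ∧ D.ncard = n}.Nonempty := by
      refine Set.nonempty_iff_ne_empty.2 fun he => ?_
      have : toidNumber (subdivision T) = 0 := by rw [toidNumber, he, Nat.sInf_empty]
      omega
    exact Nat.sInf_mem hne
  obtain ⟨H, A, htrace, hcard⟩ := hD.exists_isTOIDSTrace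
  obtain ⟨c, hc⟩ := htrace.exists_isStarPathPartition hLS (by omega)
  exact hc.inFamilyF hT
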